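/- Let A = {1,...,n}, let f : 2^A → [0,1] be a submodular set function that is pseudo-symmetric, i.e. there exist h : ℕ → [0,1], a set T ⊆ A, and v ∈ [0,1] such that f(S) = h(|S|) + v·1[S = T] for every S ⊆ A, and let c_1 ≤ c_2 ≤ ... ≤ c_n be nonnegative costs. Let ε ∈ (0,1) and define the collection C = {∅} ∪ { {1,...,i} : i ∈ {1,...,n} } ∪ { S ⊆ A : |S| ≤ 2/ε }. Then max_{S ∈ C} g(S) ≥ (1 − ε) · max_{S ⊆ A} g(S). -/

import Mathlib

open Classical in
/-- The principal's utility `g(S) = (1 - ∑_{i ∈ S} c_i / (f(S) - f(S \ {i}))) · f(S)` in the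
multi-agent contract model, valued in `EReal`, interpreted as `-∞` whenever some agent `i ∈ S`
has positive cost `c i > 0` but zero marginal contribution `f(S) - f(S \ {i}) = 0`.
(When `c i = 0` and the marginal is `0`, the term `c i / 0 = 0`, matching the convention.) -/
noncomputable def principalUtility {ι : Type*} [DecidableEq ι]
    (f : Finset ι → ℝ) (c : ι → ℝ) (S : Finset ι) : EReal :=
  if ∃ i ∈ S, 0 < c i ∧ f S - f (S.erase i) = 0 then ⊥
  else (((1 - ∑ i ∈ S, c i / (f S - f (S.erase i))) * f S : ℝ) : EReal)

/-- The sum of the marginals of the elements of `U ⊆ S` with respect to `S` is at most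
`f U - f ∅` for submodular `f`. -/
theorem sum_marginal_le_of_submodular {ι : Type*} [DecidableEq ι] (f : Finset ι → ℝ)
    (hsub : ∀ S S' : Finset ι, S ⊆ S' → ∀ i : ι,
      f (insert i S') - f S' ≤ f (insert i S) - f S)
    (S U : Finset ι) (hU : U ⊆ S) :
    ∑ i ∈ U, (f S - f (S.erase i)) ≤ f U - f ∅ := by
  induction U using Finset.induction_on with
  | empty => simp
  | insert a U ha ih =>
    rw [Finset.insert_subset_iff] at hU
    rw [Finset.sum_insert ha]
    have h1 := hsub U (S.erase a)
      (fun x hx => Finset.mem_erase.2 ⟨fun e => ha (e ▸ hx), hU.2 hx⟩) a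
    rw [Finset.insert_erase hU.1] at h1
    linarith [ih hU.2]

/-- A submodular function, with the inequality required for every element, is monotone. -/
theorem erase_le_of_submodular {ι : Type*} [DecidableEq ι] (f : Finset ι → ℝ)
    (hsub : ∀ S S' : Finset ι, S ⊆ S' → ∀ i : ι,
      f (insert i S') - f S' ≤ f (insert i S) - f S)
    (S : Finset ι) (i : ι) : f (S.erase i) ≤ f S := by
  by_cases hi : i ∈ S
  · have h1 := hsub (S.erase i) S (Finset.erase_subset _ _) i
    rw [Finset.insert_erase hi, Finset.insert_eq_of_mem hi] at h1
    linarith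
  · rw [Finset.erase_eq_of_notMem hi]

/-- The initial segment of length `k ≤ #S` has the least total cost when costs are sorted. -/
theorem sum_initial_segment_le {n : ℕ} (c : Fin n → ℝ) (hc0 : ∀ i, 0 ≤ c i)
    (hcmono : ∀ i j : Fin n, i ≤ j → c i ≤ c j) (S : Finset (Fin n)) (P : Finset (Fin n))
    (hP : ∀ i ∈ P, ∀ j ∉ P, i ≤ j) (hcard : P.card ≤ S.card) :
    ∑ i ∈ P, c i ≤ ∑ i ∈ S, c i := by
  rcases P.eq_empty_or_nonempty with rfl | hne
  · simpa using Finset.sum_nonneg fun i _ => hc0 i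
  · have h1 : ∑ i ∈ P \ S, c i ≤ (P \ S).card • c (P.max' hne) :=
      Finset.sum_le_card_nsmul _ _ _ fun i hi =>
        hcmono _ _ (P.le_max' i (Finset.mem_sdiff.1 hi).1)
    have h2 : (S \ P).card • c (P.max' hne) ≤ ∑ i ∈ S \ P, c i :=
      Finset.card_nsmul_le_sum _ _ _ fun i hi =>
        hcmono _ _ (hP _ (P.max'_mem hne) i (Finset.mem_sdiff.1 hi).2)
    have h3 : (P \ S).card ≤ (S \ P).card := by
      have e1 := Finset.card_sdiff_add_card_inter P S
      have e2 := Finset.card_sdiff_add_card_inter S P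
      rw [Finset.inter_comm] at e2
      omega
    have h4 : (P \ S).card • c (P.max' hne) ≤ (S \ P).card • c (P.max' hne) :=
      nsmul_le_nsmul_left (hc0 _) h3
    have e1 := Finset.sum_inter_add_sum_sdiff P S c
    have e2 := Finset.sum_inter_add_sum_sdiff S P c
    rw [Finset.inter_comm] at e2
    linarith

/-- If all marginals of `S` are at most `M`, all marginals of `P` are at least `M`, and `P` is
no more costly than `S`, then the utility of `P` is at least `f P / f S` times that of `S`. -/
theorem mul_principalUtility_le {ι : Type*} [DecidableEq ι] (f : Finset ι → ℝ) (c : ι → ℝ)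
    (hc0 : ∀ i, 0 ≤ c i) (S P : Finset ι) (M a : ℝ)
    (hS0 : ∀ i ∈ S, 0 ≤ f S - f (S.erase i)) (hSM : ∀ i ∈ S, f S - f (S.erase i) ≤ M)
    (hPM : ∀ i ∈ P, M ≤ f P - f (P.erase i)) (hcost : ∑ i ∈ P, c i ≤ ∑ i ∈ S, c i)
    (hfP : 0 ≤ f P) (ha : 0 < a) (haf : a * f S ≤ f P)
    (hpos : 0 ≤ 1 - ∑ i ∈ S, c i / (f S - f (S.erase i))) :
    (a : EReal) * principalUtility f c S ≤ principalUtility f c P := by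
  by_cases hS : ∃ i ∈ S, 0 < c i ∧ f S - f (S.erase i) = 0
  · rw [principalUtility, if_pos hS, EReal.coe_mul_bot_of_pos ha]
    exact bot_le
  have hM : (∀ i ∈ P, c i = 0) ∨ 0 < M := by
    by_cases hz : ∃ i ∈ S, 0 < c i
    · obtain ⟨i, hi, hci⟩ := hz
      right
      refine lt_of_lt_of_le (lt_of_le_of_ne (hS0 i hi) fun e => hS ⟨i, hi, hci, e.symm⟩) (hSM i hi)
    · left
      push Not at hz
      have h0 : ∑ i ∈ P, c i = 0 :=
        le_antisymm (hcost.trans (Finset.sum_nonpos hz)) (Finset.sum_nonneg fun i _ => hc0 i)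
      exact (Finset.sum_eq_zero_iff_of_nonneg fun i _ => hc0 i).1 h0
  have hP : ¬ ∃ i ∈ P, 0 < c i ∧ f P - f (P.erase i) = 0 := by
    rintro ⟨i, hi, hci, he⟩
    rcases hM with hM | hM
    · exact hci.ne' (hM i hi)
    · linarith [hPM i hi]
  have hsum : ∑ i ∈ P, c i / (f P - f (P.erase i)) ≤ ∑ i ∈ S, c i / (f S - f (S.erase i)) := by
    rcases hM with hM | hM
    · rw [Finset.sum_eq_zero fun i hi => by rw [hM i hi, zero_div]]
      exact Finset.sum_nonneg fun i hi => div_nonneg (hc0 i) (hS0 i hi)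
    · calc ∑ i ∈ P, c i / (f P - f (P.erase i)) ≤ ∑ i ∈ P, c i / M :=
            Finset.sum_le_sum fun i hi => div_le_div_of_nonneg_left (hc0 i) hM (hPM i hi)
        _ = (∑ i ∈ P, c i) / M := (Finset.sum_div _ _ _).symm
        _ ≤ (∑ i ∈ S, c i) / M := by gcongr
        _ = ∑ i ∈ S, c i / M := Finset.sum_div _ _ _
        _ ≤ _ := Finset.sum_le_sum fun i hi => by
            rcases (hc0 i).eq_or_lt with h0 | h0
            · simp [← h0]
            · exact div_le_div_of_nonneg_left (hc0 i)
                (lt_of_le_of_ne (hS0 i hi) fun e => hS ⟨i, hi, h0, e.symm⟩) (hSM i hi)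
  rw [principalUtility, principalUtility, if_neg hS, if_neg hP, ← EReal.coe_mul,
    EReal.coe_le_coe_iff]
  calc a * ((1 - ∑ i ∈ S, c i / (f S - f (S.erase i))) * f S)
      = (1 - ∑ i ∈ S, c i / (f S - f (S.erase i))) * (a * f S) := by ring
    _ ≤ (1 - ∑ i ∈ S, c i / (f S - f (S.erase i))) * f P := by gcongr
    _ ≤ _ := by gcongr

theorem stmt19 (n : ℕ) (f : Finset (Fin n) → ℝ)
    (hf01 : ∀ S : Finset (Fin n), 0 ≤ f S ∧ f S ≤ 1)
    (hsub : ∀ S S' : Finset (Fin n), S ⊆ S' → ∀ i : Fin n,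
      f (insert i S') - f S' ≤ f (insert i S) - f S)
    (h : ℕ → ℝ) (hh : ∀ t : ℕ, 0 ≤ h t ∧ h t ≤ 1)
    (T : Finset (Fin n)) (v : ℝ) (hv : 0 ≤ v ∧ v ≤ 1)
    (hf : ∀ S : Finset (Fin n),
      f S = h S.card + v * (if S = T then (1 : ℝ) else 0))
    (c : Fin n → ℝ) (hc0 : ∀ i, 0 ≤ c i)
    (hcmono : ∀ i j : Fin n, i ≤ j → c i ≤ c j)
    (ε : ℝ) (hε0 : 0 < ε) (hε1 : ε < 1) :
    ((1 - ε : ℝ) : EReal) * (⨆ S : Finset (Fin n), principalUtility f c S)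
      ≤ ⨆ S ∈ ((Finset.range (n + 1)).image
            (fun k => (Finset.univ : Finset (Fin n)).filter (fun j : Fin n => (j : ℕ) < k))
          ∪ (Finset.univ : Finset (Fin n)).powerset.filter
            (fun S => (S.card : ℝ) ≤ 2 / ε)),
          principalUtility f c S := by
  have hmono := erase_le_of_submodular f hsub
  have hε : 0 < 1 - ε := by linarith
  obtain ⟨S, hS⟩ := exists_eq_ciSup_of_finite (f := fun S => principalUtility f c S)
  have hS' : ∀ U, principalUtility f c U ≤ principalUtility f c S := fun U =>
    hS ▸ le_iSup (fun S => principalUtility f c S) U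
  rw [← hS]
  have hempty : principalUtility f c ∅ = (f ∅ : ℝ) := by simp [principalUtility]
  have hnonneg : 0 ≤ principalUtility f c S := by
    refine le_trans ?_ (hS' ∅)
    rw [hempty]
    exact_mod_cast (hf01 ∅).1
  by_cases hsmall : (S.card : ℝ) ≤ 2 / ε
  · refine le_trans ?_ (le_iSup₂_of_le S (Finset.mem_union_right _ ?_) le_rfl)
    · calc ((1 - ε : ℝ) : EReal) * principalUtility f c S ≤ 1 * principalUtility f c S := by
            refine mul_le_mul_of_nonneg_right ?_ hnonneg
            exact_mod_cast (by linarith : 1 - ε ≤ 1)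
        _ = _ := one_mul _
    · simpa using hsmall
  push Not at hsmall
  have hkε : 2 < S.card * ε := (div_lt_iff₀ hε0).1 hsmall
  have hk3 : 3 ≤ S.card := by
    have : (2 : ℝ) < S.card := by nlinarith [Nat.cast_nonneg (α := ℝ) S.card]
    exact_mod_cast this
  have hkn : S.card ≤ n := by simpa using S.card_le_univ
  by_cases hpos : 0 ≤ 1 - ∑ i ∈ S, c i / (f S - f (S.erase i))
  swap
  · have hle : principalUtility f c S ≤ 0 := by
      unfold principalUtility
      split_ifs
      · exact bot_le
      · exact_mod_cast mul_nonpos_of_nonpos_of_nonneg (not_le.1 hpos).le (hf01 S).1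
    refine le_trans ?_ (le_iSup₂_of_le ∅ (Finset.mem_union_right _ ?_) le_rfl)
    · rw [le_antisymm hle hnonneg, mul_zero, hempty]
      exact_mod_cast (hf01 ∅).1
    · simp only [Finset.mem_filter, Finset.mem_powerset, Finset.empty_subset, Finset.card_empty,
        Nat.cast_zero, true_and]
      positivity
  have hcardP : ∀ k ≤ n, ((Finset.univ : Finset (Fin n)).filter
      (fun j : Fin n => (j : ℕ) < k)).card = k := by
    intro k hk
    rw [Fin.card_filter_val_lt, min_eq_right hk]
  have key : ∀ k ≤ S.card, ∀ M : ℝ, (∀ i ∈ S, f S - f (S.erase i) ≤ M) →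
      (∀ P : Finset (Fin n), P.card = k → (∀ i ∈ P, M ≤ f P - f (P.erase i)) ∧
        (1 - ε) * f S ≤ f P) →
      ((1 - ε : ℝ) : EReal) * principalUtility f c S
        ≤ ⨆ S ∈ ((Finset.range (n + 1)).image
            (fun k => (Finset.univ : Finset (Fin n)).filter (fun j : Fin n => (j : ℕ) < k))
          ∪ (Finset.univ : Finset (Fin n)).powerset.filter
            (fun S => (S.card : ℝ) ≤ 2 / ε)),
          principalUtility f c S := by
    intro k hk M hM hP
    obtain ⟨h1, h2⟩ := hP _ (hcardP k (hk.trans hkn))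
    refine le_trans ?_ (le_iSup₂_of_le _ (Finset.mem_union_left _ (Finset.mem_image_of_mem _
      (Finset.mem_range.2 (Nat.lt_succ_of_le (hk.trans hkn))))) le_rfl)
    refine mul_principalUtility_le f c hc0 S _ M (1 - ε)
      (fun i _ => sub_nonneg.2 (hmono S i)) hM h1 ?_ (hf01 _).1 hε h2 hpos
    refine sum_initial_segment_le c hc0 hcmono S _ ?_ ((hcardP k (hk.trans hkn)).trans_le hk)
    intro i hi j hj
    simp only [Finset.mem_filter, Finset.mem_univ, true_and, not_lt] at hi hj
    exact Fin.le_def.2 (by omega)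
  have hfne : ∀ U, U ≠ T → f U = h U.card := fun U hU => by rw [hf U, if_neg hU]; ring
  have hfge : ∀ U, h U.card ≤ f U := fun U => by
    rw [hf U]
    split_ifs <;> linarith [hv.1]
  have hne_card : ∀ U : Finset (Fin n), U.card ≠ T.card → U ≠ T := fun U hU e => hU (e ▸ rfl)
  by_cases hT : T.card = S.card - 2
  · have hval : ∀ P : Finset (Fin n), P.card = S.card →
        f P = h S.card ∧ ∀ i ∈ P, f (P.erase i) = h (S.card - 1) := by
      intro P hP
      refine ⟨by rw [hfne P (hne_card _ (by omega)), hP], fun i hi => ?_⟩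
      have hc := Finset.card_erase_of_mem hi
      rw [hfne _ (hne_card _ (by omega)), hc, hP]
    refine key S.card le_rfl (h S.card - h (S.card - 1)) ?_ ?_
    · intro i hi
      rw [(hval S rfl).1, (hval S rfl).2 i hi]
    · intro P hP
      refine ⟨fun i hi => by rw [(hval P hP).1, (hval P hP).2 i hi], ?_⟩
      rw [(hval P hP).1, (hval S rfl).1]
      nlinarith [(hh S.card).1]
  · have hinj : ∀ i ∈ S, ∀ j ∈ S, S.erase i = T → S.erase j = T → i = j := by
      intro i hi j hj h1 h2
      by_contra hij
      have : j ∈ S.erase i := Finset.mem_erase.2 ⟨Ne.symm hij, hj⟩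
      rw [h1, ← h2] at this
      exact Finset.notMem_erase j S this
    refine key (S.card - 1) (Nat.sub_le _ _) (h (S.card - 1) - h (S.card - 2)) ?_ ?_
    · intro i hi
      obtain ⟨l, hl, hlT⟩ : ∃ l ∈ S.erase i, S.erase l ≠ T := by
        have h2 : 1 < (S.erase i).card := by
          rw [Finset.card_erase_of_mem hi]
          omega
        obtain ⟨a, ha, b, hb, hab⟩ := Finset.one_lt_card.1 h2
        by_cases haT : S.erase a = T
        · exact ⟨b, hb, fun hbT => hab
            (hinj a (Finset.mem_of_mem_erase ha) b (Finset.mem_of_mem_erase hb) haT hbT)⟩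
        · exact ⟨a, ha, haT⟩
      obtain ⟨hli, hlS⟩ := Finset.mem_erase.1 hl
      have hil : i ∈ S.erase l := Finset.mem_erase.2 ⟨hli.symm, hi⟩
      have h1 := hsub ((S.erase l).erase i) (S.erase i)
        (Finset.erase_subset_erase i (Finset.erase_subset l S)) i
      rw [Finset.insert_erase hi, Finset.insert_erase hil] at h1
      have hc1 := Finset.card_erase_of_mem hlS
      have hc2 := Finset.card_erase_of_mem hil
      rw [hfne _ hlT, hfne ((S.erase l).erase i) (hne_card _ (by omega)), hc2, hc1] at h1
      exact h1
    · intro P hP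
      constructor
      · intro i hi
        have hc := Finset.card_erase_of_mem hi
        have h1 := hfge P
        rw [hfne (P.erase i) (hne_card _ (by omega)), hc, hP]
        rw [hP] at h1
        exact sub_le_sub_right h1 _
      · have h1 := hfge P
        rw [hP] at h1
        refine le_trans ?_ h1
        obtain ⟨a, ha, hU⟩ : ∃ a ∈ S, ∀ i ∈ S.erase a, S.erase i ≠ T := by
          by_cases hex : ∃ a ∈ S, S.erase a = T
          · obtain ⟨a, ha, haT⟩ := hex
            exact ⟨a, ha, fun i hi hiT => Finset.ne_of_mem_erase hi
              (hinj i (Finset.mem_of_mem_erase hi) a ha hiT haT)⟩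
          · push Not at hex
            obtain ⟨a, ha⟩ := Finset.card_pos.1 (by omega : 0 < S.card)
            exact ⟨a, ha, fun i hi => hex i (Finset.mem_of_mem_erase hi)⟩
        have h2 := sum_marginal_le_of_submodular f hsub S (S.erase a) (Finset.erase_subset _ _)
        have h3 : ∑ i ∈ S.erase a, (f S - f (S.erase i))
            = ((S.card : ℝ) - 1) * (f S - h (S.card - 1)) := by
          rw [Finset.sum_congr rfl (g := fun _ => f S - h (S.card - 1)) (fun i hi => by
            rw [hfne _ (hU i hi), Finset.card_erase_of_mem (Finset.mem_of_mem_erase hi)]),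
            Finset.sum_const, Finset.card_erase_of_mem ha, nsmul_eq_mul,
            Nat.cast_sub (by omega), Nat.cast_one]
        have h4 := hmono S a
        have h5 : ((S.card : ℝ) - 1) * (f S - h (S.card - 1)) ≤ f S := by
          linarith [(hf01 ∅).1]
        have h6 : 1 ≤ ((S.card : ℝ) - 1) * ε := by linarith
        have hk0 : (0 : ℝ) < (S.card : ℝ) - 1 := by nlinarith
        have h7 : ((S.card : ℝ) - 1) * (f S - h (S.card - 1)) ≤ ((S.card : ℝ) - 1) * (ε * f S) := by
          nlinarith [(hf01 S).1]
        linarith [le_of_mul_le_mul_left h7 hk0]
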